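/- arXiv:2506.14219 — 3 statements merged into one kernel-verified Lean document; each statement's English description precedes it below -/
import Mathlib

section
/- Let G be a finite group of cardinality N and let U be a nonempty subset of G of cardinality k. Then G contains a subset S = {s_1, ..., s_ℓ} of cardinality ℓ satisfying ℓ ≥ N/k², such that the left translates s_1·U, s_2·U, ..., s_ℓ·U are pairwise disjoint. -/
/-- If `S` is maximal among the finite sets whose left translates of a nonempty set `U` are pairwise
disjoint, then every element of the group has the form `s * (u * v⁻¹)` with `s ∈ S`, `u, v ∈ U`. -/
theorem exists_eq_mul_div_of_maximal_pairwiseDisjoint {G : Type*} [Group G] {U : Set G}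
    (hU : U.Nonempty) {S : Finset G}
    (hS : Maximal (fun S : Finset G =>
      (S : Set G).PairwiseDisjoint (fun s => (s * ·) '' U)) S) (g : G) :
    ∃ s ∈ S, ∃ u ∈ U, ∃ v ∈ U, s * (u * v⁻¹) = g := by
  classical
  obtain ⟨w, hw⟩ := hU
  by_contra! h
  have hg : g ∉ S := fun hgS => h g hgS w hw w hw (by simp)
  refine hg (hS.le_of_ge ?_ (Finset.subset_insert g S) (Finset.mem_insert_self g S))
  rw [Finset.coe_insert]
  refine hS.prop.insert fun s hs _ => Set.disjoint_left.2 ?_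
  rintro _ ⟨v, hv, rfl⟩ ⟨u, hu, huv⟩
  exact h s hs u hu v hv (by rw [← mul_assoc, mul_inv_eq_iff_eq_mul]; exact huv)

theorem stmt4 (G : Type*) [Group G] [Fintype G] (U : Finset G) (hU : U.Nonempty) :
    ∃ S : Finset G,
      (Fintype.card G : ℝ) / (U.card : ℝ) ^ 2 ≤ (S.card : ℝ) ∧
      (S : Set G).PairwiseDisjoint (fun s => (s * ·) '' (U : Set G)) := by
  obtain ⟨S, -, hS⟩ := Finite.exists_le_maximal (a := (∅ : Finset G))
    (p := fun S : Finset G => (S : Set G).PairwiseDisjoint (fun s => (s * ·) '' (U : Set G)))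
    (by simp)
  refine ⟨S, ?_, hS.prop⟩
  have hcard : Fintype.card G ≤ S.card * U.card ^ 2 := by
    have hsurj : Set.SurjOn (fun p : G × G × G => p.1 * (p.2.1 * p.2.2⁻¹))
        (S ×ˢ U ×ˢ U : Finset (G × G × G)) (Finset.univ : Finset G) := by
      intro g _
      obtain ⟨s, hs, u, hu, v, hv, h⟩ :=
        exists_eq_mul_div_of_maximal_pairwiseDisjoint (Finset.coe_nonempty.2 hU) hS g
      exact ⟨(s, u, v), by simp_all, h⟩
    simpa [Finset.card_product, sq] using Finset.card_le_card_of_surjOn _ hsurj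
  have hpos : (0 : ℝ) < (U.card : ℝ) ^ 2 := by
    have := hU.card_pos
    positivity
  rw [div_le_iff₀ hpos]
  exact_mod_cast hcard
end

section
/- Let G be a finite group of cardinality N and let S be a nonempty subset of G of cardinality ℓ. Then G contains a subset T = {t_1, ..., t_m} of cardinality m satisfying m ≤ (N/ℓ)·(log ℓ + 1), such that G = S·T = ⋃_{i=1}^m S·t_i. -/
/-- The concave function equal to `x` for `x ≤ 1` and to `log x + 1` for `x > 1`. -/
noncomputable def linLog (x : ℝ) : ℝ := if x ≤ 1 then x else Real.log x + 1

theorem linLog_of_one_le {x : ℝ} (hx : 1 ≤ x) : linLog x = Real.log x + 1 := by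
  unfold linLog
  split_ifs with h
  · simp [le_antisymm h hx]
  · rfl

theorem linLog_add_le_linLog {x y δ : ℝ} (h : y + δ ≤ x)
    (h_sub : x * δ ≤ x - y) : linLog y + δ ≤ linLog x := by
  rcases le_or_gt x 1 with hx | hx
  · by_cases hy1 : y ≤ 1
    · simpa [linLog, hx, hy1] using h
    · have hy1 : 1 < y := not_le.mp hy1
      have hlog : Real.log y ≤ y - 1 := Real.log_le_sub_one_of_pos (by linarith)
      simp only [linLog, hx, not_le.mpr hy1, if_true, if_false]
      linarith
  · have hx0 : 0 < x := by linarith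
    have hδ : δ ≤ 1 - y / x := by
      rw [le_sub_iff_add_le, ← le_sub_iff_add_le', div_le_iff₀ hx0]
      linarith
    rcases le_or_gt y 1 with hy1 | hy1
    · have hlog : 1 - x⁻¹ ≤ Real.log x := Real.one_sub_inv_le_log_of_pos hx0
      have hmul : 0 ≤ (1 - y) * (1 - x⁻¹) :=
        mul_nonneg (by linarith) (by linarith [inv_lt_one_of_one_lt₀ hx])
      simp only [linLog, hy1, not_le.mpr hx, if_true, if_false]
      rw [div_eq_mul_inv] at hδ
      linarith
    · have hy0 : 0 < y := by linarith
      have hlog : Real.log (y / x) ≤ y / x - 1 := Real.log_le_sub_one_of_pos (by positivity)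
      rw [Real.log_div hy0.ne' hx0.ne'] at hlog
      simp only [linLog, not_le.mpr hy1, not_le.mpr hx, if_false]
      linarith

open Classical in
theorem exists_card_mul_card_le_card_mul_card_filter {G : Type*} [Group G] [Fintype G]
    (S U : Finset G) :
    ∃ t : G, S.card * U.card ≤ Fintype.card G * (U.filter fun u => u * t⁻¹ ∈ S).card := by
  have h_sum : ∑ t : G, (U.filter fun u => u * t⁻¹ ∈ S).card = S.card * U.card := by
    have h_fiber (u : G) : (Finset.univ.filter fun t : G => u * t⁻¹ ∈ S).card = S.card := by
      refine Finset.card_nbij' (fun t => u * t⁻¹) (fun s => s⁻¹ * u) ?_ ?_ ?_ ?_ <;>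
        simp [Set.MapsTo, Set.LeftInvOn]
    have h_comm := Finset.sum_card_bipartiteAbove_eq_sum_card_bipartiteBelow
      (s := (Finset.univ : Finset G)) (t := U) (fun t u => u * t⁻¹ ∈ S)
    simp only [Finset.bipartiteAbove, Finset.bipartiteBelow, h_fiber] at h_comm
    rw [h_comm, Finset.sum_const, smul_eq_mul, mul_comm]
  by_contra! h
  have h_lt := Finset.sum_lt_sum_of_nonempty (Finset.univ_nonempty (α := G)) fun t _ => h t
  rw [← Finset.mul_sum, h_sum, Finset.sum_const, smul_eq_mul, Finset.card_univ] at h_lt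
  exact lt_irrefl _ h_lt

theorem exists_card_le_linLog_and_cover {G : Type*} [Group G] [Fintype G]
    (S : Finset G) (hS : S.Nonempty) (U : Finset G) :
    ∃ T : Finset G,
      (T.card : ℝ) ≤ (Fintype.card G : ℝ) / S.card *
        linLog (U.card / ((Fintype.card G : ℝ) / S.card)) ∧
      ∀ g ∈ U, ∃ s ∈ S, ∃ t ∈ T, g = s * t := by
  classical
  induction U using Finset.strongInduction with
  | H U ih =>
  rcases U.eq_empty_or_nonempty with rfl | hU
  · exact ⟨∅, by simp [linLog], by simp⟩
  obtain ⟨t, ht⟩ := exists_card_mul_card_le_card_mul_card_filter S U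
  set V := U.filter fun u => u * t⁻¹ ∈ S
  have hVU : V ⊆ U := Finset.filter_subset _ _
  have hVpos : 0 < V.card :=
    Nat.pos_of_mul_pos_left ((Nat.mul_pos hS.card_pos hU.card_pos).trans_le ht)
  obtain ⟨T, hT, hcover⟩ := ih (U \ V)
    (Finset.sdiff_ssubset hVU (Finset.card_pos.mp hVpos))
  refine ⟨insert t T, ?_, fun g hg => ?_⟩
  · set c : ℝ := (Fintype.card G : ℝ) / S.card with hc
    have hl : (0 : ℝ) < S.card := by exact_mod_cast hS.card_pos
    have hc0 : 0 < c := div_pos (by exact_mod_cast Fintype.card_pos) hl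
    have hsplit : ((U \ V).card : ℝ) = U.card - V.card := by
      rw [Finset.card_sdiff_of_subset hVU, Nat.cast_sub (Finset.card_le_card hVU)]
    have hV1 : (1 : ℝ) ≤ V.card := by exact_mod_cast hVpos
    have hUV : (U.card : ℝ) / c ≤ V.card := by
      have : (S.card : ℝ) * U.card ≤ Fintype.card G * V.card := by exact_mod_cast ht
      rw [div_le_iff₀ hc0, hc, mul_div_assoc', le_div_iff₀ hl]
      linarith
    have h_step : linLog ((U \ V).card / c) + 1 / c ≤ linLog (U.card / c) := by
      apply linLog_add_le_linLog
      · rw [← add_div, hsplit]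
        gcongr
        linarith
      · rw [mul_one_div, ← sub_div, hsplit]
        gcongr
        linarith
    have h_scaled := mul_le_mul_of_nonneg_left h_step hc0.le
    rw [mul_add, mul_one_div_cancel hc0.ne'] at h_scaled
    have h_insert : ((insert t T).card : ℝ) ≤ T.card + 1 := by
      exact_mod_cast Finset.card_insert_le t T
    linarith
  · by_cases hgV : g ∈ V
    · exact ⟨g * t⁻¹, (Finset.mem_filter.mp hgV).2, t, Finset.mem_insert_self _ _, by simp⟩
    · obtain ⟨s, hs, t', ht', h⟩ := hcover g (Finset.mem_sdiff.mpr ⟨hg, hgV⟩)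
      exact ⟨s, hs, t', Finset.mem_insert_of_mem ht', h⟩

theorem stmt6 (G : Type*) [Group G] [Fintype G] (S : Finset G) (hS : S.Nonempty) :
    ∃ T : Finset G,
      (T.card : ℝ) ≤ (Fintype.card G : ℝ) / (S.card : ℝ) * (Real.log (S.card : ℝ) + 1) ∧
      ∀ g : G, ∃ s ∈ S, ∃ t ∈ T, g = s * t := by
  obtain ⟨T, hT, hcover⟩ := exists_card_le_linLog_and_cover S hS Finset.univ
  refine ⟨T, ?_, fun g => hcover g (Finset.mem_univ g)⟩
  have hN : (Fintype.card G : ℝ) ≠ 0 := by exact_mod_cast Fintype.card_ne_zero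
  rwa [Finset.card_univ, div_div_cancel₀ hN,
    linLog_of_one_le (by exact_mod_cast hS.card_pos)] at hT
end

section
/- Fix 0 < p ≤ 1/2 and set r = 1/p. There exist constants c = c(p) > 0 and C = C(p) > 0 such that the following holds for every finite group G of cardinality N ≥ 2: setting k = ⌊log_r N + 10·log_r(log_r N)⌋, if A ⊆ G is Bernoulli sampled with parameter p, then for every subset U ⊆ G of cardinality k, the probability that U is shattered by the translate family T_A is at most C·e^{−c·k⁶}. -/
open MeasureTheory ProbabilityTheory

/-- `U` is shattered by the set system `F`: every subset of `U` is cut out of `U`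
by some member of `F`. -/
def Shatters {α : Type*} (F : Set (Set α)) (U : Set α) : Prop :=
  ∀ K ⊆ U, ∃ B ∈ F, B ∩ U = K

/-- The VC-dimension of a set system `F` on a ground set `α`: the maximum
cardinality of a shattered subset. -/
noncomputable def vcDim (α : Type*) (F : Set (Set α)) : ℕ :=
  sSup {n | ∃ U : Finset α, U.card = n ∧ Shatters F ↑U}

/-- The family of left translates `{tA : t ∈ G}` of a subset `A` of a group `G`. -/
def translates {G : Type*} [Group G] (A : Set G) : Set (Set G) :=
  {B | ∃ t : G, B = (t * ·) '' A}

/-- `VCdim(A)`, the VC-dimension of the family of left translates of `A`. -/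
noncomputable def vcDimTranslates (G : Type*) [Group G] (A : Set G) : ℕ :=
  vcDim G (translates A)

/-- The random subset `A : Ω → Set G` is Bernoulli sampled with parameter `p`:
the events `x ∈ A` for `x ∈ G` are mutually independent, each of probability `p`. -/
def IsBernoulliRandomSubset {Ω : Type*} (G : Type*) [MeasurableSpace Ω]
    (μ : Measure Ω) (p : ℝ) (A : Ω → Set G) : Prop :=
  iIndepSet (fun x : G => {ω | x ∈ A ω}) μ ∧
    ∀ x : G, μ {ω | x ∈ A ω} = ENNReal.ofReal p

theorem exists_pairwiseDisjoint_translates {G : Type*} [Group G] [DecidableEq G]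
    {U : Finset G} (hU : U.Nonempty) (S : Finset G) (m : ℕ)
    (h : m * U.card ^ 2 < S.card) :
    ∃ T ⊆ S, T.card = m + 1 ∧
      (T : Set G).PairwiseDisjoint fun s => U.image (s * ·) := by
  induction m with
  | zero =>
    obtain ⟨s, hs⟩ := Finset.card_pos.1 (by simpa using h)
    exact ⟨{s}, by simpa using hs, by simp, by simp⟩
  | succ m ih =>
    obtain ⟨T, hTS, hT, hd⟩ := ih (lt_of_le_of_lt (Nat.mul_le_mul_right _ m.le_succ) h)
    set bad : Finset G := (T ×ˢ (U ×ˢ U)).image fun q => q.1 * q.2.1 * q.2.2⁻¹ with hbad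
    have hcard : bad.card < S.card := by
      refine (Finset.card_image_le.trans ?_).trans_lt h
      simp [hT, sq]
    obtain ⟨s, hsS, hs⟩ := Finset.exists_mem_notMem_of_card_lt_card hcard
    have hdis : ∀ t ∈ T, Disjoint (U.image (s * ·)) (U.image (t * ·)) := by
      intro t ht
      rw [Finset.disjoint_left]
      intro x hx hx'
      obtain ⟨u, hu, rfl⟩ := Finset.mem_image.1 hx
      obtain ⟨v, hv, hvu⟩ := Finset.mem_image.1 hx'
      refine hs (Finset.mem_image.2 ⟨(t, v, u), by simp [ht, hu, hv], ?_⟩)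
      simp only at hvu ⊢
      rw [hvu, mul_inv_cancel_right]
    have hsT : s ∉ T := by
      intro hsT
      obtain ⟨u, hu⟩ := hU
      exact Finset.disjoint_left.1 (hdis s hsT) (Finset.mem_image_of_mem _ hu)
        (Finset.mem_image_of_mem _ hu)
    refine ⟨insert s T, Finset.insert_subset hsS hTS, by simp [hsT, hT], ?_⟩
    rw [Finset.coe_insert]
    exact hd.insert fun t ht _ => hdis t ht

theorem Shatters.exists_pairwiseDisjoint_translates {G : Type*} [Group G] [Fintype G]
    [DecidableEq G] {A : Set G} {U : Finset G} (hU : U.Nonempty)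
    (h : Shatters (translates A) (U : Set G))
    {m n : ℕ} (hm : m * U.card ^ 2 < U.card.choose n) :
    ∃ T : Finset G, T.card = m + 1 ∧
      (T : Set G).PairwiseDisjoint (fun s => U.image (s * ·)) ∧
      ∀ s ∈ T, ∃ K ∈ U.powersetCard n, ∀ u ∈ K, s * u ∈ A := by
  have hex : ∀ K ∈ U.powersetCard n, ∃ s : G, ∀ u ∈ U, s * u ∈ A ↔ u ∈ K := by
    intro K hK
    have hKU := (Finset.mem_powersetCard.1 hK).1
    obtain ⟨B, ⟨t, rfl⟩, hB⟩ := h K (by exact_mod_cast hKU)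
    refine ⟨t⁻¹, fun u hu => ?_⟩
    have := Set.ext_iff.1 hB u
    simpa [hu, Set.mem_image, ← eq_inv_mul_iff_mul_eq] using this
  choose! σ hσ using hex
  have hinj : Set.InjOn σ (U.powersetCard n) := by
    intro K hK L hL hKL
    ext u
    have hKU := (Finset.mem_powersetCard.1 hK).1
    have hLU := (Finset.mem_powersetCard.1 hL).1
    constructor
    · intro hu
      rw [← hσ L hL u (hKU hu), ← hKL, hσ K hK u (hKU hu)]
      exact hu
    · intro hu
      rw [← hσ K hK u (hLU hu), hKL, hσ L hL u (hLU hu)]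
      exact hu
  obtain ⟨T, hTS, hT, hd⟩ := _root_.exists_pairwiseDisjoint_translates hU
    ((U.powersetCard n).image σ) m
    (by rwa [Finset.card_image_of_injOn hinj, Finset.card_powersetCard])
  refine ⟨T, hT, hd, fun s hs => ?_⟩
  obtain ⟨K, hK, rfl⟩ := Finset.mem_image.1 (hTS hs)
  exact ⟨K, hK, fun u hu => (hσ K hK u ((Finset.mem_powersetCard.1 hK).1 hu)).2 hu⟩

theorem measure_forall_mem_eq {Ω G : Type*} [MeasurableSpace Ω] {μ : Measure Ω} {p : ℝ}
    {A : Ω → Set G} (hA : IsBernoulliRandomSubset G μ p A) (W : Finset G) :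
    μ {ω | ∀ x ∈ W, x ∈ A ω} = ENNReal.ofReal p ^ W.card := by
  have := hA.1.meas_biInter W
  simp only [hA.2, Finset.prod_const] at this
  rw [← this]
  congr 1
  ext ω
  simp

theorem measure_forall_exists_translate_le {Ω G : Type*} [MeasurableSpace Ω] [Group G]
    [DecidableEq G] {μ : Measure Ω} {p : ℝ} {A : Ω → Set G}
    (hA : IsBernoulliRandomSubset G μ p A) (U T : Finset G) (n : ℕ)
    (hd : (T : Set G).PairwiseDisjoint fun s => U.image (s * ·)) :
    μ {ω | ∀ s ∈ T, ∃ K ∈ U.powersetCard n, ∀ u ∈ K, s * u ∈ A ω} ≤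
      (U.card.choose n * ENNReal.ofReal p ^ n) ^ T.card := by
  set W : (T → Finset G) → Finset G :=
    fun f => Finset.univ.biUnion fun s : T => (f s).image ((s : G) * ·)
  set F := Fintype.piFinset fun _ : T => U.powersetCard n
  have hsub : {ω | ∀ s ∈ T, ∃ K ∈ U.powersetCard n, ∀ u ∈ K, s * u ∈ A ω} ⊆
      ⋃ f ∈ F, {ω | ∀ x ∈ W f, x ∈ A ω} := by
    intro ω hω
    choose! K hK hKA using hω
    simp only [Set.mem_iUnion]
    refine ⟨fun s => K s, Fintype.mem_piFinset.2 fun s => hK s s.2, ?_⟩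
    intro x hx
    obtain ⟨s, -, hx⟩ := Finset.mem_biUnion.1 hx
    obtain ⟨u, hu, rfl⟩ := Finset.mem_image.1 hx
    exact hKA s s.2 u hu
  have hW : ∀ f ∈ F, (W f).card = n * T.card := by
    intro f hf
    have hf' := fun s => Finset.mem_powersetCard.1 (Fintype.mem_piFinset.1 hf s)
    rw [Finset.card_biUnion]
    · simp only [Finset.card_image_of_injective _ (mul_right_injective _), (hf' _).2]
      simp [mul_comm]
    · intro s _ t _ hst
      exact (hd s.2 t.2 (Subtype.coe_injective.ne hst)).mono
        (Finset.image_subset_image (hf' s).1) (Finset.image_subset_image (hf' t).1)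
  calc _ ≤ ∑ f ∈ F, μ {ω | ∀ x ∈ W f, x ∈ A ω} :=
        (measure_mono hsub).trans (measure_biUnion_finset_le _ _)
    _ = ∑ f ∈ F, ENNReal.ofReal p ^ (n * T.card) :=
        Finset.sum_congr rfl fun f hf => by rw [measure_forall_mem_eq hA, hW f hf]
    _ = _ := by
        simp [F, Fintype.card_piFinset, mul_pow, pow_mul]

theorem measure_shatters_translates_le {Ω G : Type*} [MeasurableSpace Ω] [Group G] [Fintype G]
    {μ : Measure Ω} {p : ℝ} {A : Ω → Set G} (hA : IsBernoulliRandomSubset G μ p A)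
    {U : Finset G} (hU : U.Nonempty) {m n : ℕ} (hm : m * U.card ^ 2 < U.card.choose n) :
    μ {ω | Shatters (translates (A ω)) (U : Set G)} ≤
      (Fintype.card G * (U.card.choose n * ENNReal.ofReal p ^ n)) ^ (m + 1) := by
  classical
  set 𝒯 : Finset (Finset G) := ((Finset.univ : Finset G).powersetCard (m + 1)).filter fun T =>
    (T : Set G).PairwiseDisjoint fun s => U.image (s * ·)
  have hsub : {ω | Shatters (translates (A ω)) (U : Set G)} ⊆
      ⋃ T ∈ 𝒯, {ω | ∀ s ∈ T, ∃ K ∈ U.powersetCard n, ∀ u ∈ K, s * u ∈ A ω} := by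
    intro ω hω
    obtain ⟨T, hT, hd, h⟩ := Shatters.exists_pairwiseDisjoint_translates hU hω hm
    simp only [Set.mem_iUnion]
    exact ⟨T, Finset.mem_filter.2 ⟨Finset.mem_powersetCard.2 ⟨Finset.subset_univ _, hT⟩, hd⟩, h⟩
  have hcard : 𝒯.card ≤ Fintype.card G ^ (m + 1) :=
    (Finset.card_filter_le _ _).trans (by
      rw [Finset.card_powersetCard, Finset.card_univ]
      exact Nat.choose_le_pow _ _)
  calc _ ≤ ∑ T ∈ 𝒯, μ {ω | ∀ s ∈ T, ∃ K ∈ U.powersetCard n, ∀ u ∈ K, s * u ∈ A ω} :=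
        (measure_mono hsub).trans (measure_biUnion_finset_le _ _)
    _ ≤ ∑ T ∈ 𝒯, (U.card.choose n * ENNReal.ofReal p ^ n) ^ (m + 1) :=
        Finset.sum_le_sum fun T hT => by
          obtain ⟨hT, hd⟩ := Finset.mem_filter.1 hT
          simpa [(Finset.mem_powersetCard.1 hT).2] using
            measure_forall_exists_translate_le hA U T n hd
    _ ≤ _ := by
        rw [Finset.sum_const, nsmul_eq_mul, mul_pow (Fintype.card G : ENNReal)]
        gcongr
        exact_mod_cast hcard

theorem card_mul_pow_le {p N : ℝ} {k : ℕ} (hp0 : 0 < p) (hp : p ≤ 1 / 2) (hN : 2 ≤ N)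
    (hk : (k : ℤ) = ⌊Real.logb (1 / p) N + 10 * Real.logb (1 / p) (Real.logb (1 / p) N)⌋) :
    N * p ^ k * k ^ 10 ≤ 21 ^ 10 / p := by
  have hr : 2 ≤ 1 / p := by rw [le_div_iff₀ hp0]; linarith
  have hr1 : 1 < 1 / p := by linarith
  have hr0 : 0 < 1 / p := by linarith
  set r := 1 / p with hrdef
  set L := Real.logb r N with hL
  have hL0 : 0 < L := Real.logb_pos hr1 (by linarith)
  have hlogr : 1 / 2 ≤ Real.log r := by
    have := Real.log_two_gt_d9
    have := Real.log_le_log (by norm_num) hr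
    linarith
  have hLL : Real.logb r L ≤ 2 * L := by
    rw [Real.logb, div_le_iff₀ (by linarith)]
    have := Real.log_le_sub_one_of_pos hL0
    nlinarith
  have hk1 : (k : ℝ) ≤ L + 10 * Real.logb r L := by
    have := Int.floor_le (L + 10 * Real.logb r L)
    rw [← hk] at this
    exact_mod_cast this
  have hk2 : L + 10 * Real.logb r L < k + 1 := by
    have := Int.lt_floor_add_one (L + 10 * Real.logb r L)
    rw [← hk] at this
    exact_mod_cast this
  have hkL : (k : ℝ) ≤ 21 * L := by linarith
  have hNL : N * L ^ 10 ≤ r ^ (k + 1) := by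
    have h : Real.logb r (N * L ^ 10) ≤ (k + 1 : ℕ) := by
      rw [Real.logb_mul (by positivity) (by positivity), Real.logb_pow]
      push_cast
      linarith
    rw [Real.logb_le_iff_le_rpow hr1 (by positivity)] at h
    exact_mod_cast h
  have hpr : p ^ k * r ^ (k + 1) = 1 / p := by
    rw [pow_succ, ← mul_assoc, ← mul_pow, hrdef, mul_one_div_cancel hp0.ne', one_pow, one_mul]
  calc N * p ^ k * k ^ 10 ≤ N * p ^ k * (21 * L) ^ 10 := by gcongr
    _ = 21 ^ 10 * (p ^ k * (N * L ^ 10)) := by ring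
    _ ≤ 21 ^ 10 * (p ^ k * r ^ (k + 1)) := by gcongr
    _ = 21 ^ 10 / p := by rw [hpr]; ring

theorem pow_eight_le_choose {k : ℕ} (hk : 14 ≤ k) :
    (k : ℝ) ^ 8 ≤ 2 ^ 8 * Nat.factorial 8 * k.choose 8 := by
  have h := Nat.pow_le_choose 8 k (α := ℝ)
  have h2 : (k : ℝ) ≤ 2 * ((k + 1 - 8 : ℕ) : ℝ) := by
    exact_mod_cast (by omega : k ≤ 2 * (k + 1 - 8))
  rw [div_le_iff₀ (by positivity)] at h
  calc (k : ℝ) ^ 8 ≤ (2 * ((k + 1 - 8 : ℕ) : ℝ)) ^ 8 := by gcongr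
    _ = 2 ^ 8 * ((k + 1 - 8 : ℕ) : ℝ) ^ 8 := by ring
    _ ≤ 2 ^ 8 * (k.choose 8 * Nat.factorial 8) := by
        gcongr
    _ = _ := by ring

theorem stmt10 (p : ℝ) (hp0 : 0 < p) (hp : p ≤ 1 / 2) :
    ∃ c : ℝ, 0 < c ∧ ∃ C : ℝ, 0 < C ∧
      ∀ (G : Type) [Group G] [Fintype G] (Ω : Type) [MeasurableSpace Ω]
        (μ : Measure Ω), IsProbabilityMeasure μ →
        ∀ A : Ω → Set G,
        2 ≤ Fintype.card G →
        IsBernoulliRandomSubset G μ p A →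
        ∀ U : Finset G,
          (U.card : ℤ) = ⌊Real.logb (1 / p) (Fintype.card G) +
              10 * Real.logb (1 / p) (Real.logb (1 / p) (Fintype.card G))⌋ →
          μ {ω | Shatters (translates (A ω)) (U : Set G)} ≤
            ENNReal.ofReal (C * Real.exp (-c * (U.card : ℝ) ^ 6)) := by
  set c : ℝ := 1 / (2 ^ 8 * Nat.factorial 8) with hc
  have hc0 : 0 < c := by positivity
  set D : ℝ := 21 ^ 10 / p ^ 9 * Real.exp 1 with hD
  have hD0 : 0 < D := by positivity
  obtain ⟨k₀, hk₀⟩ := exists_nat_ge (D + 14)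
  refine ⟨c, hc0, Real.exp (c * (k₀ : ℝ) ^ 6), Real.exp_pos _, ?_⟩
  intro G _ _ Ω _ μ _ A hN hA U hU
  set k := U.card with hk
  have hC1 : 1 ≤ Real.exp (c * (k₀ : ℝ) ^ 6) := Real.one_le_exp (by positivity)
  rcases le_or_gt k k₀ with hkk | hkk
  · refine prob_le_one.trans ?_
    rw [ENNReal.one_le_ofReal, ← Real.exp_add]
    apply Real.one_le_exp
    have : (k : ℝ) ^ 6 ≤ (k₀ : ℝ) ^ 6 := by gcongr
    nlinarith
  have hkk' : (k₀ : ℝ) < k := by exact_mod_cast hkk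
  have hk14 : 14 ≤ k := by
    have : (14 : ℝ) ≤ k := by linarith
    exact_mod_cast this
  have hkpos : (0 : ℝ) < k := by linarith
  have hUne : U.Nonempty := Finset.card_pos.1 (by omega)
  have hchoose : k.choose (k - 8) = k.choose 8 := Nat.choose_symm (by omega)
  have hchoose_pos : 0 < k.choose 8 := Nat.choose_pos (by omega)
  set m := (k.choose 8 - 1) / k ^ 2 with hm
  have hm1 : m * k ^ 2 < k.choose (k - 8) := by
    have := Nat.div_mul_le_self (k.choose 8 - 1) (k ^ 2)
    rw [← hm] at this
    omega
  have hm2 : c * (k : ℝ) ^ 6 ≤ (m + 1 : ℕ) := by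
    have h1 : k.choose 8 ≤ (m + 1) * k ^ 2 := by
      have := Nat.lt_div_mul_add (a := k.choose 8 - 1) (b := k ^ 2) (by positivity)
      rw [← hm] at this
      rw [add_mul, one_mul]
      omega
    have h2 : (k.choose 8 : ℝ) ≤ ((m + 1 : ℕ) : ℝ) * k ^ 2 := by exact_mod_cast h1
    have h3 := pow_eight_le_choose hk14
    have h4 : (k : ℝ) ^ 2 * k ^ 6 ≤ k ^ 2 * (2 ^ 8 * Nat.factorial 8 * ((m + 1 : ℕ) : ℝ)) := by
      calc (k : ℝ) ^ 2 * k ^ 6 = (k : ℝ) ^ 8 := by ring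
        _ ≤ 2 ^ 8 * (Nat.factorial 8 : ℝ) * k.choose 8 := h3
        _ ≤ 2 ^ 8 * (Nat.factorial 8 : ℝ) * (((m + 1 : ℕ) : ℝ) * k ^ 2) := by gcongr
        _ = _ := by ring
    have h5 := le_of_mul_le_mul_left h4 (by positivity)
    rw [hc, one_div_mul_eq_div, div_le_iff₀ (by positivity)]
    linarith
  have hbase : (Fintype.card G : ℝ) * (k.choose 8 * p ^ (k - 8)) ≤ Real.exp (-1) := by
    have h1 := card_mul_pow_le hp0 hp (N := Fintype.card G) (by exact_mod_cast hN) hU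
    have h2 : (k.choose 8 : ℝ) ≤ k ^ 8 := by exact_mod_cast Nat.choose_le_pow k 8
    have h3 : p ^ (k - 8) * p ^ 8 = p ^ k := by rw [← pow_add]; congr 1; omega
    have h4 : D ≤ (k : ℝ) ^ 2 := by nlinarith
    refine le_of_mul_le_mul_right ?_ (by positivity : 0 < p ^ 8 * (k : ℝ) ^ 2)
    calc (Fintype.card G : ℝ) * (k.choose 8 * p ^ (k - 8)) * (p ^ 8 * (k : ℝ) ^ 2)
        ≤ (Fintype.card G : ℝ) * (k ^ 8 * p ^ (k - 8)) * (p ^ 8 * (k : ℝ) ^ 2) := by gcongr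
      _ = (Fintype.card G : ℝ) * (p ^ (k - 8) * p ^ 8) * k ^ 10 := by ring
      _ ≤ 21 ^ 10 / p := by rw [h3]; exact h1
      _ = Real.exp (-1) * (p ^ 8 * D) := by
          rw [hD, Real.exp_neg]
          field_simp
      _ ≤ Real.exp (-1) * (p ^ 8 * (k : ℝ) ^ 2) := by gcongr
  refine (measure_shatters_translates_le hA hUne hm1).trans ?_
  rw [← hk, hchoose]
  calc ((Fintype.card G : ENNReal) * (k.choose 8 * ENNReal.ofReal p ^ (k - 8))) ^ (m + 1)
      = ENNReal.ofReal (((Fintype.card G : ℝ) * (k.choose 8 * p ^ (k - 8))) ^ (m + 1)) := by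
        rw [ENNReal.ofReal_pow (by positivity), ENNReal.ofReal_mul (by positivity),
          ENNReal.ofReal_mul (by positivity), ENNReal.ofReal_pow hp0.le,
          ENNReal.ofReal_natCast, ENNReal.ofReal_natCast]
    _ ≤ _ := by
        apply ENNReal.ofReal_le_ofReal
        calc _ ≤ Real.exp (-1) ^ (m + 1) := by gcongr
          _ = Real.exp (-((m + 1 : ℕ) : ℝ)) := by rw [← Real.exp_nat_mul]; ring_nf
          _ ≤ Real.exp (-c * (k : ℝ) ^ 6) := by
              apply Real.exp_le_exp.2
              linarith
          _ ≤ _ := le_mul_of_one_le_left (Real.exp_pos _).le hC1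
end
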